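/- Let (βᵢ) be a sequence in (1,2) such that the βᵢ-expansion of 1 terminates for each i, let (mᵢ) be natural numbers, and (p̄ᵢ) vectors in [0,1]^{2^{mᵢ}}. Then dim_H(⋂ᵢ {x ∈ [0,1) : p̄ᵢ ∈ A^{βᵢ,mᵢ}(x)}) = infᵢ dim_H({x : p̄ᵢ ∈ A^{βᵢ,mᵢ}(x)}). -/

import Mathlib

open Set MeasureTheory Filter
open scoped ENNReal Classical

noncomputable section

/-- A similarity transformation of `ℝ`. -/
def IsSimilarity (f : ℝ → ℝ) : Prop := ∃ a b : ℝ, a ≠ 0 ∧ ∀ x, f x = a * x + b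

/-- Falconer's class `𝒢^s`: Gδ sets all of whose images under countably many
similarities intersect in a set of Hausdorff dimension at least `s`. -/
def falconerClass (s : ℝ) : Set (Set ℝ) :=
  {F | IsGδ F ∧ ∀ T : ℕ → ℝ → ℝ, (∀ i, IsSimilarity (T i)) →
    ENNReal.ofReal s ≤ dimH (⋂ i, T i '' F)}

/-- The β-transformation `x ↦ βx mod 1`. -/
def betaMap (β : ℝ) (x : ℝ) : ℝ := Int.fract (β * x)

/-- The digits `d_n(x,β) = ⌊β f_β^n(x)⌋` of the greedy `β`-expansion. -/
def betaDigit (β x : ℝ) (n : ℕ) : ℤ := ⌊β * (betaMap β)^[n] x⌋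

/-- The `β`-expansion of `1` terminates: `d(1,β) = j₀ … j_{k-1} 0^∞`. -/
def TerminatesAtOne (β : ℝ) : Prop := ∃ N : ℕ, ∀ n ≥ N, betaDigit β 1 n = 0

/-- The cylinder `[i₀ … i_{n-1}] ⊆ [0,1)` of the `β`-expansion. -/
def betaCyl (β : ℝ) (w : List ℤ) : Set ℝ :=
  {x ∈ Ico (0:ℝ) 1 | ∀ k (hk : k < w.length), betaDigit β x k = w.get ⟨k, hk⟩}

/-- The outer measure `N^s_∞` from countable covers by cylinders of the `β`-expansion. -/
def betaCylMeasure (β s : ℝ) (A : Set ℝ) : ℝ≥0∞ :=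
  ⨅ (c : ℕ → List ℤ) (_ : A ⊆ ⋃ i, betaCyl β (c i)),
    ∑' i, volume (betaCyl β (c i)) ^ s

/-- The empirical frequency `τ^β_w(x,n)/(n-m)` of the binary word `w` of length `m`
among the first `n` digits of the `β`-expansion of `x`. -/
def betaFreq (β : ℝ) {m : ℕ} (w : Fin m → Fin 2) (x : ℝ) (n : ℕ) : ℝ :=
  (((Finset.range (n - m)).filter
      (fun i => ∀ k : Fin m, betaDigit β x (i + k) = ((w k : ℕ) : ℤ))).card : ℝ) / ((n - m : ℕ) : ℝ)

/-- `G^{β,m}_{p̄}`: points whose length-`m` word frequencies in the `β`-expansion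
converge to `p̄`. -/
def betaGset (β : ℝ) (m : ℕ) (p : (Fin m → Fin 2) → ℝ) : Set ℝ :=
  {x ∈ Ico (0:ℝ) 1 | ∀ w : Fin m → Fin 2,
    Tendsto (fun n => betaFreq β w x n) atTop (nhds (p w))}

/-- `G^{β,m}_{p̄}(n,ε)`: points whose empirical frequencies at time `n` are within `ε`
of `p̄` componentwise. -/
def betaGsetApprox (β : ℝ) (m : ℕ) (p : (Fin m → Fin 2) → ℝ) (n : ℕ) (ε : ℝ) : Set ℝ :=
  {x ∈ Ico (0:ℝ) 1 | ∀ w : Fin m → Fin 2, |betaFreq β w x n - p w| < ε}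

/-- `p̄ ∈ A^{β,m}(x)`: `p̄` is an accumulation point of the empirical frequency vectors
of the `β`-expansion of `x`. -/
def betaFreqAccum (β : ℝ) (m : ℕ) (p : (Fin m → Fin 2) → ℝ) (x : ℝ) : Prop :=
  MapClusterPt p atTop (fun n => fun w => betaFreq β w x n)

/-- The constant `Q(s,β) = β^{-s} Σ_{i=0}^∞ (1 - 1/β)^{is}`. -/
def Qconst (s β : ℝ) : ℝ := β ^ (-s) * ∑' i : ℕ, ((1 - 1/β) ^ i) ^ s


/-- The `s`-dimensional Hausdorff content on `ℝ`. -/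
def hausdorffContent (s : ℝ) : OuterMeasure ℝ :=
  OuterMeasure.ofFunction (fun A => ⨆ _ : A.Nonempty, Metric.ediam A ^ s) (by simp)

lemma hausdorffContent_le_ediam (s : ℝ) (A : Set ℝ) :
    hausdorffContent s A ≤ Metric.ediam A ^ s :=
  (OuterMeasure.ofFunction_le A).trans (iSup_le fun _ => le_rfl)

lemma hausdorffContent_Ico_le {s : ℝ} (hs : 0 ≤ s) (a : ℝ) {r : ℝ} (hr : 0 ≤ r) :
    hausdorffContent s (Ico a (a + r)) ≤ ENNReal.ofReal (r ^ s) := by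
  refine (hausdorffContent_le_ediam s _).trans ?_
  rw [← ENNReal.ofReal_rpow_of_nonneg hr hs]
  refine ENNReal.rpow_le_rpow ?_ hs
  simp

lemma hausdorffContent_le_hausdorffMeasure (s : ℝ) (A : Set ℝ) :
    hausdorffContent s A ≤ Measure.hausdorffMeasure s A := by
  rw [Measure.hausdorffMeasure_apply, hausdorffContent, OuterMeasure.ofFunction_apply]
  refine le_trans ?_ (le_iSup₂ (⊤ : ℝ≥0∞) (by simp))
  refine iInf₂_mono fun t _ => ?_
  simp

lemma hausdorffContent_of_countable {s : ℝ} (hs : 0 < s) {A : Set ℝ} (hA : A.Countable) :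
    hausdorffContent s A = 0 := by
  rw [← biUnion_of_singleton A]
  refine (measure_biUnion_null_iff hA).2 fun x _ => ?_
  refine le_antisymm ((hausdorffContent_le_ediam s _).trans ?_) bot_le
  simp [hs]

lemma hausdorffMeasure_eq_zero_of_hausdorffContent {s : ℝ} (hs : 0 < s) {A : Set ℝ}
    (hA : hausdorffContent s A = 0) : Measure.hausdorffMeasure s A = 0 := by
  rw [hausdorffContent, OuterMeasure.ofFunction_apply] at hA
  rw [Measure.hausdorffMeasure_apply]
  simp only [ENNReal.iSup_eq_zero]
  intro r hr
  refine le_antisymm (le_of_forall_gt fun ε hε => ?_) bot_le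
  have hr' : 0 < min ε (r ^ s) := lt_min hε (ENNReal.rpow_pos_of_nonneg hr hs.le)
  rw [← hA] at hr'
  simp only [iInf_lt_iff] at hr'
  obtain ⟨t, ht, hlt⟩ := hr'
  refine lt_of_le_of_lt (iInf₂_le_of_le t ht (iInf_le _ ?_)) (hlt.trans_le (min_le_left _ _))
  intro n
  rcases (t n).eq_empty_or_nonempty with h | h
  · simp [h]
  have h1 : Metric.ediam (t n) ^ s ≤ r ^ s := by
    refine le_trans ?_ (hlt.le.trans (min_le_right _ _))
    refine le_trans ?_ (ENNReal.le_tsum n)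
    simp [h]
  exact (ENNReal.rpow_le_rpow_iff hs).1 h1

lemma le_hausdorffContent_image_affine {s : ℝ} (hs : 0 < s) (A : Set ℝ) (a : ℝ) {r : ℝ}
    (hr : 0 < r) :
    ENNReal.ofReal (r ^ s) * hausdorffContent s A ≤
      hausdorffContent s ((fun y => a + r * y) '' A) := by
  have hrs : 0 < r ^ s := Real.rpow_pos_of_pos hr s
  simp only [hausdorffContent, OuterMeasure.ofFunction_apply]
  refine le_iInf₂ fun t ht => ?_
  have hcov : A ⊆ ⋃ n, (fun y => a + r * y) ⁻¹' t n := by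
    rw [← preimage_iUnion]; exact image_subset_iff.1 ht
  have hle : (⨅ (u : ℕ → Set ℝ) (_ : A ⊆ ⋃ n, u n),
      ∑' n, ⨆ _ : (u n).Nonempty, Metric.ediam (u n) ^ s) ≤ _ :=
    iInf₂_le (fun n => (fun y => a + r * y) ⁻¹' t n) hcov
  refine (mul_le_mul' le_rfl hle).trans ?_
  rw [← ENNReal.tsum_mul_left]
  refine ENNReal.tsum_le_tsum fun n => ?_
  rcases ((fun y => a + r * y) ⁻¹' t n).eq_empty_or_nonempty with h | h
  · simp [h]
  have hn : (t n).Nonempty := let ⟨_, hy⟩ := h; ⟨_, hy⟩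
  simp only [h, hn, iSup_pos]
  have hanti : AntilipschitzWith (Real.toNNReal r⁻¹) (fun y : ℝ => a + r * y) := by
    refine AntilipschitzWith.of_le_mul_dist fun x y => ?_
    rw [Real.coe_toNNReal _ (by positivity), Real.dist_eq, Real.dist_eq,
      show a + r * x - (a + r * y) = r * (x - y) by ring, abs_mul, abs_of_pos hr]
    field_simp
    exact le_rfl
  have h1 := ENNReal.rpow_le_rpow (hanti.ediam_preimage_le (t n)) hs.le
  refine (mul_le_mul' le_rfl h1).trans ?_
  rw [ENNReal.mul_rpow_of_nonneg _ _ hs.le, ← mul_assoc]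
  change ENNReal.ofReal (r ^ s) * ENNReal.ofReal r⁻¹ ^ s * _ ≤ _
  rw [ENNReal.ofReal_rpow_of_nonneg (by positivity) hs.le, ← ENNReal.ofReal_mul hrs.le,
    Real.inv_rpow hr.le, mul_inv_cancel₀ hrs.ne']
  simp

/-- The half-open dyadic interval `[k 2⁻ⁿ, (k+1) 2⁻ⁿ)`. -/
def dyadicIco (n k : ℕ) : Set ℝ := Ico (k * (1 / 2 : ℝ) ^ n) (k * (1 / 2 : ℝ) ^ n + (1 / 2) ^ n)

/-- The closed dyadic interval `[k 2⁻ⁿ, (k+1) 2⁻ⁿ]`. -/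
def dyadicIcc (n k : ℕ) : Set ℝ := Icc (k * (1 / 2 : ℝ) ^ n) (k * (1 / 2 : ℝ) ^ n + (1 / 2) ^ n)

lemma dyadicIcc_child_subset (n k : ℕ) : dyadicIcc (n + 1) k ⊆ dyadicIcc n (k / 2) := by
  have hp : (0 : ℝ) < (1 / 2) ^ n := by positivity
  have h : (k : ℝ) = 2 * (k / 2 : ℕ) + (k % 2 : ℕ) := by exact_mod_cast (Nat.div_add_mod k 2).symm
  have h1 : ((k % 2 : ℕ) : ℝ) ≤ 1 := by exact_mod_cast Nat.lt_succ_iff.1 (Nat.mod_lt k two_pos)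
  have h0 : (0 : ℝ) ≤ (k % 2 : ℕ) := Nat.cast_nonneg _
  rw [dyadicIcc, dyadicIcc, h, pow_succ]
  apply Icc_subset_Icc <;> nlinarith

lemma dyadicIco_subset_children (n k : ℕ) :
    dyadicIco n k ⊆ dyadicIco (n + 1) (2 * k) ∪ dyadicIco (n + 1) (2 * k + 1) := by
  rintro x ⟨h1, h2⟩
  simp only [dyadicIco, pow_succ, mem_union, mem_Ico]
  push_cast
  rcases lt_or_ge x (k * (1 / 2) ^ n + (1 / 2) ^ n * (1 / 2)) with h | h
  · left; constructor <;> linarith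
  · right; constructor <;> linarith

/-- The maximal flow from the node `(n, k)` of the dyadic tree to those descendants of relative
depth `d` which lie inside `U`, when nodes of level `m` have capacity `a ^ m`. -/
def cutVal (a : ℝ) (U : Set ℝ) : ℕ → ℕ → ℕ → ℝ
  | 0, n, k => if dyadicIcc n k ⊆ U then a ^ n else 0
  | d + 1, n, k => min (a ^ n) (cutVal a U d (n + 1) (2 * k) + cutVal a U d (n + 1) (2 * k + 1))

section Tree

variable {a : ℝ} {U : Set ℝ}

lemma cutVal_nonneg (ha : 0 ≤ a) (d n k : ℕ) : 0 ≤ cutVal a U d n k := by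
  induction d generalizing n k with
  | zero => rw [cutVal]; split_ifs <;> positivity
  | succ d ih => exact le_min (by positivity) (add_nonneg (ih _ _) (ih _ _))

lemma cutVal_le (ha : 0 ≤ a) (d n k : ℕ) : cutVal a U d n k ≤ a ^ n := by
  cases d with
  | zero => rw [cutVal]; split_ifs <;> [exact le_rfl; positivity]
  | succ d => exact min_le_left _ _

lemma dyadicIcc_children_subset {n k : ℕ} (h : dyadicIcc n k ⊆ U) :
    dyadicIcc (n + 1) (2 * k) ⊆ U ∧ dyadicIcc (n + 1) (2 * k + 1) ⊆ U := by
  have h0 := dyadicIcc_child_subset n (2 * k)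
  have h1 := dyadicIcc_child_subset n (2 * k + 1)
  rw [show 2 * k / 2 = k by omega] at h0
  rw [show (2 * k + 1) / 2 = k by omega] at h1
  exact ⟨h0.trans h, h1.trans h⟩

lemma cutVal_of_subset (ha : 1 / 2 ≤ a) (d : ℕ) {n k : ℕ} (h : dyadicIcc n k ⊆ U) :
    cutVal a U d n k = a ^ n := by
  induction d generalizing n k with
  | zero => rw [cutVal, if_pos h]
  | succ d ih =>
    obtain ⟨h0, h1⟩ := dyadicIcc_children_subset h
    rw [cutVal, ih h0, ih h1, min_eq_left]
    have : 0 ≤ a ^ n := by positivity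
    rw [pow_succ]; nlinarith

lemma cutVal_mono (ha : 1 / 2 ≤ a) (n k : ℕ) : Monotone fun d => cutVal a U d n k := by
  have ha0 : 0 ≤ a := by linarith
  refine monotone_nat_of_le_succ fun d => ?_
  induction d generalizing n k with
  | zero =>
    by_cases h : dyadicIcc n k ⊆ U
    · rw [cutVal_of_subset ha 0 h, cutVal_of_subset ha _ h]
    · rw [cutVal, if_neg h]; exact cutVal_nonneg ha0 _ _ _
  | succ d ih => exact min_le_min le_rfl (add_le_add (ih _ _) (ih _ _))

/-- The limit of `cutVal` as the depth grows. -/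
def cutLim (a : ℝ) (U : Set ℝ) (n k : ℕ) : ℝ := ⨆ d, cutVal a U d n k

lemma tendsto_cutVal (ha : 1 / 2 ≤ a) (n k : ℕ) :
    Tendsto (fun d => cutVal a U d n k) atTop (nhds (cutLim a U n k)) := by
  refine tendsto_atTop_ciSup (cutVal_mono ha n k) ⟨a ^ n, ?_⟩
  rintro _ ⟨d, rfl⟩
  exact cutVal_le (by linarith) d n k

lemma cutLim_of_subset (ha : 1 / 2 ≤ a) {n k : ℕ} (h : dyadicIcc n k ⊆ U) :
    cutLim a U n k = a ^ n := by
  simp [cutLim, cutVal_of_subset ha _ h]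

lemma cutLim_nonneg (ha : 1 / 2 ≤ a) (n k : ℕ) : 0 ≤ cutLim a U n k :=
  ge_of_tendsto' (tendsto_cutVal ha n k) fun d => cutVal_nonneg (by linarith) d n k

lemma cutLim_eq (ha : 1 / 2 ≤ a) (n k : ℕ) : cutLim a U n k =
    min (a ^ n) (cutLim a U (n + 1) (2 * k) + cutLim a U (n + 1) (2 * k + 1)) := by
  refine tendsto_nhds_unique ((tendsto_add_atTop_iff_nat 1).2 (tendsto_cutVal ha n k)) ?_
  exact tendsto_const_nhds.min ((tendsto_cutVal ha _ _).add (tendsto_cutVal ha _ _))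

/-- The union of the maximal dyadic intervals at which the limit flow meets the capacity and which
lie exactly `j` levels below the node `(n, k)`. -/
def freshSet (a : ℝ) (U : Set ℝ) : ℕ → ℕ → ℕ → Set ℝ
  | 0, n, k => if cutLim a U n k = a ^ n then dyadicIco n k else ∅
  | j + 1, n, k => if cutLim a U n k = a ^ n then ∅ else
      freshSet a U j (n + 1) (2 * k) ∪ freshSet a U j (n + 1) (2 * k + 1)

/-- The total capacity of the intervals that make up `freshSet`. -/
def freshVal (a : ℝ) (U : Set ℝ) : ℕ → ℕ → ℕ → ℝ
  | 0, n, k => if cutLim a U n k = a ^ n then a ^ n else 0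
  | j + 1, n, k => if cutLim a U n k = a ^ n then 0 else
      freshVal a U j (n + 1) (2 * k) + freshVal a U j (n + 1) (2 * k + 1)

lemma freshVal_nonneg (ha : 0 ≤ a) (j n k : ℕ) : 0 ≤ freshVal a U j n k := by
  induction j generalizing n k with
  | zero => rw [freshVal]; split_ifs <;> positivity
  | succ j ih => rw [freshVal]; split_ifs <;> [exact le_rfl; exact add_nonneg (ih _ _) (ih _ _)]

lemma sum_freshVal_le (ha : 1 / 2 ≤ a) (d n k : ℕ) :
    ∑ j ∈ Finset.range d, freshVal a U j n k ≤ cutLim a U n k := by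
  induction d generalizing n k with
  | zero => simpa using cutLim_nonneg ha n k
  | succ d ih =>
    rw [Finset.sum_range_succ']
    by_cases h : cutLim a U n k = a ^ n
    · simp [freshVal, h]
    · simp only [freshVal, h, if_false, Finset.sum_add_distrib, add_zero]
      have he := cutLim_eq (U := U) ha n k
      rcases min_choice (a ^ n) (cutLim a U (n + 1) (2 * k) + cutLim a U (n + 1) (2 * k + 1))
        with h' | h'
      · exact absurd (he.trans h') h
      · rw [he, h']
        exact add_le_add (ih _ _) (ih _ _)

lemma inter_dyadicIco_subset_iUnion_freshSet (ha : 1 / 2 ≤ a) (hU : IsOpen U) (n k : ℕ) :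
    U ∩ dyadicIco n k ⊆ ⋃ j, freshSet a U j n k := by
  rintro x ⟨hxU, hx⟩
  obtain ⟨ε, hε, hball⟩ := Metric.isOpen_iff.1 hU x hxU
  obtain ⟨D, hD⟩ := exists_pow_lt_of_lt_one hε (show (1 / 2 : ℝ) < 1 by norm_num)
  have hsub : ∀ n k, D ≤ n → x ∈ dyadicIco n k → dyadicIcc n k ⊆ U := by
    rintro n k hn ⟨h1, h2⟩ y ⟨h3, h4⟩
    apply hball
    have : (1 / 2 : ℝ) ^ n ≤ (1 / 2) ^ D := pow_le_pow_of_le_one (by norm_num) (by norm_num) hn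
    rw [Metric.mem_ball, Real.dist_eq, abs_lt]
    constructor <;> linarith
  suffices h : ∀ e n k, D ≤ n + e → x ∈ dyadicIco n k → ∃ j, x ∈ freshSet a U j n k from
    mem_iUnion.2 (h D n k (by omega) hx)
  intro e
  induction e with
  | zero =>
    intro n k hn hx
    exact ⟨0, by rw [freshSet, if_pos (cutLim_of_subset ha (hsub n k hn hx))]; exact hx⟩
  | succ e ih =>
    intro n k hn hx
    by_cases h : cutLim a U n k = a ^ n
    · exact ⟨0, by rw [freshSet, if_pos h]; exact hx⟩
    · rcases dyadicIco_subset_children n k hx with hx | hx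
      · obtain ⟨j, hj⟩ := ih _ _ (by omega) hx
        exact ⟨j + 1, by rw [freshSet, if_neg h]; exact Or.inl hj⟩
      · obtain ⟨j, hj⟩ := ih _ _ (by omega) hx
        exact ⟨j + 1, by rw [freshSet, if_neg h]; exact Or.inr hj⟩

lemma hausdorffContent_freshSet_le {s : ℝ} (hs : 0 ≤ s) (j n k : ℕ) :
    hausdorffContent s (freshSet ((1 / 2) ^ s) U j n k) ≤
      ENNReal.ofReal (freshVal ((1 / 2) ^ s) U j n k) := by
  have ha : (0 : ℝ) ≤ (1 / 2) ^ s := by positivity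
  induction j generalizing n k with
  | zero =>
    rw [freshSet, freshVal]
    split_ifs
    · refine (hausdorffContent_Ico_le hs _ (by positivity)).trans (ENNReal.ofReal_le_ofReal ?_)
      rw [Real.rpow_pow_comm (by norm_num)]
    · simp
  | succ j ih =>
    rw [freshSet, freshVal]
    split_ifs
    · simp
    · rw [ENNReal.ofReal_add (freshVal_nonneg ha _ _ _) (freshVal_nonneg ha _ _ _)]
      exact (measure_union_le _ _).trans (add_le_add (ih _ _) (ih _ _))

lemma half_lt_half_rpow {s : ℝ} (hs : s < 1) : (1 / 2 : ℝ) < (1 / 2) ^ s := by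
  simpa using Real.rpow_lt_rpow_of_exponent_gt (x := 1 / 2) (by norm_num) (by norm_num) hs

lemma hausdorffContent_inter_dyadicIco_le {s : ℝ} (hs : 0 ≤ s) (hs1 : s < 1) (hU : IsOpen U)
    (n k : ℕ) : hausdorffContent s (U ∩ dyadicIco n k) ≤
      ENNReal.ofReal (cutLim ((1 / 2) ^ s) U n k) := by
  have ha := (half_lt_half_rpow hs1).le
  refine (measure_mono (inter_dyadicIco_subset_iUnion_freshSet ha hU n k)).trans ?_
  refine (measure_iUnion_le _).trans ?_
  refine (ENNReal.tsum_le_tsum fun j => hausdorffContent_freshSet_le hs j n k).trans ?_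
  refine ENNReal.tsum_le_of_sum_range_le fun d => ?_
  rw [← ENNReal.ofReal_sum_of_nonneg fun j _ => freshVal_nonneg (by linarith) j n k]
  exact ENNReal.ofReal_le_ofReal (sum_freshVal_le ha d n k)

lemma cutLim_eq_of_uniform_lower_bound (ha : 1 / 2 < a) {c : ℝ} (hc : 0 < c)
    (h : ∀ n k, k < 2 ^ n → c * a ^ n ≤ cutLim a U n k) {n k : ℕ} (hk : k < 2 ^ n) :
    cutLim a U n k = a ^ n := by
  have hle : ∀ r n k, k < 2 ^ n → min 1 (c * (2 * a) ^ r) * a ^ n ≤ cutLim a U n k := by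
    intro r
    induction r with
    | zero =>
      intro n k hk
      refine le_trans ?_ (h n k hk)
      gcongr
      simp
    | succ r ih =>
      intro n k hk
      have h0 := ih (n + 1) (2 * k) (by rw [pow_succ]; omega)
      have h1 := ih (n + 1) (2 * k + 1) (by rw [pow_succ]; omega)
      have hpow : 0 < a ^ n := by positivity
      rw [cutLim_eq ha.le, le_min_iff]
      constructor
      · exact mul_le_of_le_one_left hpow.le (min_le_left _ _)
      · refine le_trans ?_ (add_le_add h0 h1)
        rw [← two_mul, pow_succ a n, show ∀ m : ℝ, 2 * (m * (a ^ n * a)) = (2 * a * m) * a ^ n by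
          intro m; ring]
        refine mul_le_mul_of_nonneg_right ?_ hpow.le
        rw [mul_min_of_nonneg _ _ (by linarith)]
        refine min_le_min (by linarith) (le_of_eq ?_)
        ring
  obtain ⟨r, hr⟩ := pow_unbounded_of_one_lt c⁻¹ (show 1 < 2 * a by linarith)
  have h1 : 1 ≤ c * (2 * a) ^ r := by
    rw [inv_lt_iff_one_lt_mul₀ hc] at hr
    linarith
  have h2 := hle r n k hk
  rw [min_eq_left h1, one_mul] at h2
  refine le_antisymm ?_ h2
  rw [cutLim_eq ha.le]
  exact min_le_left _ _

lemma exists_mul_le_cutVal (ha : 1 / 2 ≤ a) {n : ℕ} (h : ∀ k < 2 ^ n, cutLim a U n k = a ^ n)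
    {θ : ℝ} (hθ : θ < 1) : ∃ d, 0 < d ∧ ∀ k < 2 ^ n, θ * a ^ n ≤ cutVal a U d n k := by
  have hpow : 0 < a ^ n := by positivity
  have hev : ∀ᶠ d in atTop, ∀ k ∈ Finset.range (2 ^ n), θ * a ^ n ≤ cutVal a U d n k := by
    rw [Finset.eventually_all]
    intro k hk
    have ht := tendsto_cutVal (U := U) ha n k
    rw [h k (Finset.mem_range.1 hk)] at ht
    exact ht.eventually_const_le (by nlinarith)
  obtain ⟨d, hd, hd0⟩ := (hev.and (eventually_gt_atTop 0)).exists
  exact ⟨d, hd0, fun k hk => hd k (Finset.mem_range.2 hk)⟩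

end Tree

/-- `μ` is a unit mass on the dyadic tree, distributed consistently over the levels up to `N`, which
gives mass at most `C * a ^ n` to each node of level `n`. -/
structure IsDyadicMass (a C : ℝ) (N : ℕ) (μ : ℕ → ℕ → ℝ) : Prop where
  nonneg : ∀ n ≤ N, ∀ k, 0 ≤ μ n k
  add : ∀ n < N, ∀ k, μ n k = μ (n + 1) (2 * k) + μ (n + 1) (2 * k + 1)
  bound : ∀ n ≤ N, ∀ k, μ n k ≤ C * a ^ n
  supp : ∀ n ≤ N, ∀ k, 2 ^ n ≤ k → μ n k = 0
  root : μ 0 0 = 1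

/-- Extend `μ` from level `N` downwards, splitting the mass in proportion to `W`. -/
def splitMass (μ W : ℕ → ℕ → ℝ) (N : ℕ) : ℕ → ℕ → ℝ
  | 0, k => μ 0 k
  | n + 1, k => if n + 1 ≤ N then μ (n + 1) k else
      splitMass μ W N n (k / 2) *
        (W (n + 1) k / (W (n + 1) (2 * (k / 2)) + W (n + 1) (2 * (k / 2) + 1)))

lemma splitMass_of_le (μ W : ℕ → ℕ → ℝ) {N n : ℕ} (h : n ≤ N) : splitMass μ W N n = μ n := by
  cases n with
  | zero => rfl
  | succ n => ext k; rw [splitMass, if_pos h]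

lemma IsDyadicMass.exists_refine {a C : ℝ} {N : ℕ} {μ : ℕ → ℕ → ℝ} (hμ : IsDyadicMass a C N μ)
    (ha : 1 / 2 ≤ a) (hC0 : 0 < C) (hC : C < 2) {U : Set ℝ}
    (hU : ∀ k < 2 ^ N, cutLim a U N k = a ^ N) :
    ∃ N' > N, ∃ C' μ', 0 < C' ∧ C' < 2 ∧ IsDyadicMass a C' N' μ' ∧ (∀ n ≤ N, μ' n = μ n) ∧
      ∀ k, μ' N' k ≠ 0 → dyadicIcc N' k ⊆ U := by
  obtain ⟨C', hCC', hC'⟩ := exists_between hC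
  have hC'0 : 0 < C' := hC0.trans hCC'
  have ha0 : 0 ≤ a := by linarith
  obtain ⟨d, hd, hcut⟩ := exists_mul_le_cutVal ha hU (θ := C / C') (by rw [div_lt_one hC'0]; exact hCC')
  set W : ℕ → ℕ → ℝ := fun n k => cutVal a U (N + d - n) n k with hW
  have hW0 : ∀ n k, 0 ≤ W n k := fun n k => cutVal_nonneg ha0 _ _ _
  have hWle : ∀ n < N + d, ∀ k, W n k ≤ W (n + 1) (2 * k) + W (n + 1) (2 * k + 1) := by
    intro n hn k
    simp only [hW]
    obtain ⟨e, he⟩ : ∃ e, N + d - n = e + 1 := ⟨N + d - n - 1, by omega⟩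
    rw [he, show N + d - (n + 1) = e by omega]
    exact min_le_right _ _
  set ν := splitMass μ W N with hν
  have hold : ∀ n ≤ N, ν n = μ n := fun n hn => splitMass_of_le μ W hn
  have hnew : ∀ n, N ≤ n → ∀ k, ν (n + 1) k = ν n (k / 2) *
      (W (n + 1) k / (W (n + 1) (2 * (k / 2)) + W (n + 1) (2 * (k / 2) + 1))) := by
    intro n hn k
    rw [hν, splitMass, if_neg (by omega)]
  have hmain : ∀ e ≤ d, ∀ k, 0 ≤ ν (N + e) k ∧ ν (N + e) k ≤ C' * W (N + e) k ∧
      (2 ^ (N + e) ≤ k → ν (N + e) k = 0) := by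
    intro e
    induction e with
    | zero =>
      intro _ k
      rw [add_zero, hold N le_rfl]
      refine ⟨hμ.nonneg N le_rfl k, ?_, hμ.supp N le_rfl k⟩
      rcases lt_or_ge k (2 ^ N) with hk | hk
      · have h1 := hcut k hk
        have h2 := hμ.bound N le_rfl k
        simp only [hW, show N + d - N = d by omega]
        calc μ N k ≤ C * a ^ N := h2
          _ = C' * (C / C' * a ^ N) := by field_simp
          _ ≤ _ := by gcongr
      · rw [hμ.supp N le_rfl k hk]
        exact mul_nonneg hC'0.le (hW0 _ _)
    | succ e ih =>
      intro he k
      obtain ⟨i1, i2, i3⟩ := ih (by omega) (k / 2)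
      have hle := hWle (N + e) (by omega) (k / 2)
      rw [← add_assoc, hnew (N + e) (by omega)]
      set S := W (N + e + 1) (2 * (k / 2)) + W (N + e + 1) (2 * (k / 2) + 1) with hS
      have hS0 : 0 ≤ S := add_nonneg (hW0 _ _) (hW0 _ _)
      refine ⟨mul_nonneg i1 (div_nonneg (hW0 _ _) hS0), ?_, fun hk => ?_⟩
      · rcases hS0.eq_or_lt with h | h
        · rw [← h, div_zero, mul_zero]; exact mul_nonneg hC'0.le (hW0 _ _)
        · calc ν (N + e) (k / 2) * (W (N + e + 1) k / S)
              ≤ (C' * S) * (W (N + e + 1) k / S) :=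
                mul_le_mul_of_nonneg_right (i2.trans (by gcongr)) (div_nonneg (hW0 _ _) hS0)
            _ = C' * W (N + e + 1) k := by field_simp
      · rw [i3 (by rw [pow_succ] at hk; omega), zero_mul]
  refine ⟨N + d, by omega, C', ν, hC'0, hC', ⟨?_, ?_, ?_, ?_, ?_⟩, hold, ?_⟩
  · intro n hn k
    rcases le_or_gt n N with h | h
    · rw [hold n h]; exact hμ.nonneg n h k
    · obtain ⟨e, rfl⟩ := Nat.exists_eq_add_of_lt h
      exact (hmain (e + 1) (by omega) k).1
  · intro n hn k
    rcases lt_or_ge n N with h | h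
    · rw [hold n h.le, hold (n + 1) h]; exact hμ.add n h k
    · have h2 : ν n k ≤ C' * W n k := by
        obtain ⟨e, rfl⟩ := Nat.exists_eq_add_of_le h
        exact (hmain e (by omega) k).2.1
      have h1 : 0 ≤ ν n k := by
        obtain ⟨e, rfl⟩ := Nat.exists_eq_add_of_le h
        exact (hmain e (by omega) k).1
      have hle := hWle n hn k
      rw [hnew n h, hnew n h, show 2 * k / 2 = k by omega, show (2 * k + 1) / 2 = k by omega,
        ← mul_add, ← add_div]
      rcases eq_or_ne (W (n + 1) (2 * k) + W (n + 1) (2 * k + 1)) 0 with hz | hz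
      · rw [hz, div_zero, mul_zero]
        rw [hz] at hle
        nlinarith
      · rw [div_self hz, mul_one]
  · intro n hn k
    have hpow : 0 ≤ a ^ n := by positivity
    rcases le_or_gt n N with h | h
    · rw [hold n h]
      exact (hμ.bound n h k).trans (by gcongr)
    · obtain ⟨e, rfl⟩ := Nat.exists_eq_add_of_lt h
      refine (hmain (e + 1) (by omega) k).2.1.trans ?_
      exact mul_le_mul_of_nonneg_left (cutVal_le ha0 _ _ _) hC'0.le
  · intro n hn k hk
    rcases le_or_gt n N with h | h
    · rw [hold n h]; exact hμ.supp n h k hk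
    · obtain ⟨e, rfl⟩ := Nat.exists_eq_add_of_lt h
      exact (hmain (e + 1) (by omega) k).2.2 hk
  · rw [hold 0 (Nat.zero_le _)]; exact hμ.root
  · intro k hk
    by_contra hsub
    obtain ⟨h1, h2, -⟩ := hmain d le_rfl k
    have : W (N + d) k = 0 := by simp only [hW, Nat.sub_self, cutVal, if_neg hsub]
    rw [this, mul_zero] at h2
    exact hk (le_antisymm h2 h1)

lemma IsDyadicMass.sum_le_sum_image {a C : ℝ} {N : ℕ} {μ : ℕ → ℕ → ℝ} (hμ : IsDyadicMass a C N μ)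
    (m e : ℕ) (h : m + e ≤ N) (S : Finset ℕ) :
    ∑ k ∈ S, μ (m + e) k ≤ ∑ k ∈ S.image (· / 2 ^ e), μ m k := by
  induction e generalizing S with
  | zero => simp
  | succ e ih =>
    have h1 : ∑ k ∈ S, μ (m + e + 1) k ≤ ∑ k ∈ S.image (· / 2), μ (m + e) k := by
      rw [← Finset.sum_fiberwise_of_maps_to (g := (· / 2)) (t := S.image (· / 2))
        (fun x hx => Finset.mem_image_of_mem _ hx)]
      refine Finset.sum_le_sum fun k _ => ?_
      rw [hμ.add (m + e) (by omega) k, ← Finset.sum_pair (f := μ (m + e + 1)) (by omega)]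
      refine Finset.sum_le_sum_of_subset_of_nonneg ?_ fun i _ _ => hμ.nonneg _ (by omega) i
      intro i hi
      simp only [Finset.mem_filter, Finset.mem_insert, Finset.mem_singleton] at hi ⊢
      omega
    refine h1.trans ((ih (by omega) _).trans (le_of_eq ?_))
    rw [Finset.image_image]
    congr 1
    ext i
    simp [Function.comp_def, Nat.div_div_eq_div_mul, pow_succ']

lemma IsDyadicMass.sum_eq_one {a C : ℝ} {N : ℕ} {μ : ℕ → ℕ → ℝ} (hμ : IsDyadicMass a C N μ)
    {n : ℕ} (hn : n ≤ N) : ∑ k ∈ Finset.range (2 ^ n), μ n k = 1 := by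
  have hsum : ∀ (f : ℕ → ℝ) M, ∑ k ∈ Finset.range (2 * M), f k =
      ∑ k ∈ Finset.range M, (f (2 * k) + f (2 * k + 1)) := by
    intro f M
    induction M with
    | zero => simp
    | succ M ih =>
      rw [Finset.sum_range_succ, ← ih, mul_add, mul_one, Finset.sum_range_succ,
        Finset.sum_range_succ, add_assoc]
  induction n with
  | zero => simpa using hμ.root
  | succ n ih =>
    rw [pow_succ', hsum, ← ih (by omega)]
    exact Finset.sum_congr rfl fun k _ => (hμ.add n (by omega) k).symm

lemma IsDyadicMass.le_ancestor {a C : ℝ} {N : ℕ} {μ : ℕ → ℕ → ℝ} (hμ : IsDyadicMass a C N μ)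
    (m e : ℕ) (h : m + e ≤ N) (k : ℕ) : μ (m + e) k ≤ μ m (k / 2 ^ e) := by
  simpa using hμ.sum_le_sum_image m e h {k}

lemma dyadicIcc_subset_ancestor (m e k : ℕ) :
    dyadicIcc (m + e) k ⊆ dyadicIcc m (k / 2 ^ e) := by
  induction e generalizing k with
  | zero => simp
  | succ e ih =>
    refine (dyadicIcc_child_subset (m + e) k).trans ((ih _).trans (le_of_eq ?_))
    rw [Nat.div_div_eq_div_mul, pow_succ']

lemma left_mem_dyadicIcc (n k : ℕ) : (k : ℝ) * (1 / 2) ^ n ∈ dyadicIcc n k :=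
  left_mem_Icc.2 (le_add_of_nonneg_right (by positivity))

lemma exists_dyadicMass_seq {a : ℝ} (ha : 1 / 2 ≤ a) (U : ℕ → Set ℝ)
    (hU : ∀ j n k, k < 2 ^ n → cutLim a (U j) n k = a ^ n) :
    ∃ N : ℕ → ℕ, StrictMono N ∧ ∃ K : ℕ → Set ℝ, (∀ i, IsCompact (K i) ∧ K i ⊆ U i) ∧
      ∀ j, ∃ μ, IsDyadicMass a 2 (N j) μ ∧
        ∀ k, μ (N j) k ≠ 0 → ∀ i < j, (k : ℝ) * (1 / 2) ^ N j ∈ K i := by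
  have ha0 : 0 ≤ a := by linarith
  let State := {p : ℕ × ℝ × (ℕ → ℕ → ℝ) // 0 < p.2.1 ∧ p.2.1 < 2 ∧ IsDyadicMass a p.2.1 p.1 p.2.2}
  have hstep : ∀ (j : ℕ) (p : State), ∃ q : State, p.1.1 < q.1.1 ∧
      (∀ n ≤ p.1.1, q.1.2.2 n = p.1.2.2 n) ∧
      ∀ k, q.1.2.2 q.1.1 k ≠ 0 → dyadicIcc q.1.1 k ⊆ U j := by
    rintro j ⟨⟨N, C, μ⟩, hC0, hC, hμ⟩
    obtain ⟨N', hN', C', μ', h0, h2, hμ', hold, hsub⟩ :=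
      hμ.exists_refine ha hC0 hC (U := U j) (fun k hk => hU j N k hk)
    exact ⟨⟨⟨N', C', μ'⟩, h0, h2, hμ'⟩, hN', hold, hsub⟩
  choose next hlt hagree hsub using hstep
  have hinit : IsDyadicMass a 1 0 (fun n k => if n = 0 ∧ k = 0 then 1 else 0) := by
    refine ⟨?_, by simp, ?_, ?_, by simp⟩
    · intro n _ k; split_ifs <;> norm_num
    · intro n hn k
      obtain rfl : n = 0 := by omega
      split_ifs <;> norm_num
    · intro n hn k hk
      obtain rfl : n = 0 := by omega
      simp at hk ⊢
      omega
  let f : ℕ → State := fun j => Nat.rec ⟨⟨0, 1, _⟩, one_pos, one_lt_two, hinit⟩ next j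
  have hf : ∀ j, f (j + 1) = next j (f j) := fun j => rfl
  have hmono : StrictMono fun j => (f j).1.1 :=
    strictMono_nat_of_lt_succ fun j => by rw [hf]; exact hlt j (f j)
  have hag : ∀ i j, i ≤ j → ∀ n ≤ (f i).1.1, (f j).1.2.2 n = (f i).1.2.2 n := by
    intro i j hij
    induction j, hij using Nat.le_induction with
    | base => intro n _; rfl
    | succ j hij ih =>
      intro n hn
      rw [hf, hagree j (f j) n (hn.trans (hmono.monotone hij)), ih n hn]
  refine ⟨fun j => (f j).1.1, hmono,
    fun i => ⋃ k ∈ {k | k < 2 ^ (f (i + 1)).1.1 ∧ dyadicIcc (f (i + 1)).1.1 k ⊆ U i},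
      dyadicIcc (f (i + 1)).1.1 k, fun i => ⟨?_, ?_⟩, fun j => ⟨(f j).1.2.2, ?_, ?_⟩⟩
  · refine Set.Finite.isCompact_biUnion ?_ fun k _ => isCompact_Icc
    exact (finite_lt_nat _).subset fun k hk => hk.1
  · exact iUnion₂_subset fun k hk => hk.2
  · obtain ⟨_, h2, hμ⟩ := (f j).2
    exact ⟨hμ.nonneg, hμ.add,
      fun n hn k => (hμ.bound n hn k).trans (by have : 0 ≤ a ^ n := by positivity
                                                gcongr), hμ.supp, hμ.root⟩
  · intro k hk i hij
    have hμ := (f j).2.2.2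
    obtain ⟨e, he⟩ := Nat.exists_eq_add_of_le (hmono.monotone (Nat.succ_le_of_lt hij))
    simp only [Nat.succ_eq_add_one] at he
    have hpos : (f j).1.2.2 (f (i + 1)).1.1 (k / 2 ^ e) ≠ 0 := by
      have h1 := hμ.le_ancestor (f (i + 1)).1.1 e he.ge k
      rw [← he] at h1
      exact (((hμ.nonneg _ le_rfl k).lt_of_ne hk.symm).trans_le h1).ne'
    have hlt : k / 2 ^ e < 2 ^ (f (i + 1)).1.1 := by
      by_contra! h
      exact hpos (hμ.supp _ (by omega) _ h)
    rw [hag (i + 1) j hij _ le_rfl] at hpos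
    refine mem_biUnion (x := k / 2 ^ e) ⟨hlt, ?_⟩ ?_
    · exact hsub i (f i) _ hpos
    · apply dyadicIcc_subset_ancestor
      rw [← he]
      exact left_mem_dyadicIcc _ _

lemma IsDyadicMass.sum_ball_le {s C : ℝ} (hs : 0 < s) (hs1 : s < 1) (hC : 1 ≤ C) {N : ℕ}
    {μ : ℕ → ℕ → ℝ} (hμ : IsDyadicMass ((1 / 2) ^ s) C N μ) (x : ℝ) {δ : ℝ}
    (hδ : (1 / 2) ^ N ≤ δ) {S : Finset ℕ} (hS : S ⊆ Finset.range (2 ^ N))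
    (hball : ∀ k ∈ S, (k : ℝ) * (1 / 2) ^ N ∈ Metric.ball x δ) :
    ∑ k ∈ S, μ N k ≤ 8 * C * δ ^ s := by
  have hδ0 : 0 < δ := lt_of_lt_of_le (by positivity) hδ
  rcases le_or_gt δ 1 with h1 | h1
  · obtain ⟨m, hm1, hm2⟩ := exists_nat_pow_near_of_lt_one hδ0 h1
      (show (0 : ℝ) < 1 / 2 by norm_num) (by norm_num)
    have hmN : m ≤ N := by
      by_contra! h
      have h2 : (1 / 2 : ℝ) ^ m < (1 / 2) ^ N :=
        pow_lt_pow_right_of_lt_one₀ (by norm_num) (by norm_num) h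
      linarith
    obtain ⟨e, rfl⟩ := Nat.exists_eq_add_of_le hmN
    refine (hμ.sum_le_sum_image m e le_rfl S).trans ?_
    have hcard : (S.image (· / 2 ^ e)).card ≤ 4 := by
      rcases S.eq_empty_or_nonempty with rfl | hne
      · simp
      have hsub : S.image (· / 2 ^ e) ⊆
          Finset.Icc (S.min' hne / 2 ^ e) (S.min' hne / 2 ^ e + 2) := by
        intro q hq
        obtain ⟨k, hk, rfl⟩ := Finset.mem_image.1 hq
        have hmin := S.min'_le k hk
        have b1 := hball k hk
        have b2 := hball _ (S.min'_mem hne)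
        rw [Metric.mem_ball, Real.dist_eq, abs_lt] at b1 b2
        have hlt : (k : ℝ) < S.min' hne + 2 * 2 ^ e := by
          have hp : (0 : ℝ) < (1 / 2) ^ (m + e) := by positivity
          have he : (1 / 2 : ℝ) ^ m = 2 ^ e * (1 / 2) ^ (m + e) := by
            rw [pow_add, mul_left_comm, ← mul_pow]; norm_num
          refine lt_of_mul_lt_mul_right ?_ hp.le
          linarith
        have hlt' : k < S.min' hne + 2 * 2 ^ e := by exact_mod_cast hlt
        rw [Finset.mem_Icc]
        refine ⟨Nat.div_le_div_right hmin, ?_⟩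
        rw [← Nat.add_mul_div_right _ _ (by positivity : 0 < 2 ^ e)]
        exact Nat.div_le_div_right hlt'.le
      refine (Finset.card_le_card hsub).trans ?_
      rw [Nat.card_Icc]
      omega
    have hb : ∀ k ∈ S.image (· / 2 ^ e), μ m k ≤ C * (2 * δ ^ s) := by
      intro k _
      refine (hμ.bound m (by omega) k).trans ?_
      refine mul_le_mul_of_nonneg_left ?_ (by linarith)
      rw [Real.rpow_pow_comm (by norm_num)]
      calc ((1 / 2 : ℝ) ^ m) ^ s ≤ (2 * δ) ^ s := by
            refine Real.rpow_le_rpow (by positivity) ?_ hs.le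
            rw [pow_succ] at hm1; linarith
        _ = 2 ^ s * δ ^ s := Real.mul_rpow (by norm_num) hδ0.le
        _ ≤ 2 * δ ^ s := by
            gcongr
            simpa using Real.rpow_le_rpow_of_exponent_le (x := 2) (by norm_num) hs1.le
    refine (Finset.sum_le_card_nsmul _ _ _ hb).trans ?_
    rw [nsmul_eq_mul]
    have : ((S.image (· / 2 ^ e)).card : ℝ) ≤ 4 := by exact_mod_cast hcard
    have h0 : 0 ≤ C * (2 * δ ^ s) := by positivity
    nlinarith
  · have h2 : ∑ k ∈ S, μ N k ≤ 1 := by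
      rw [← hμ.sum_eq_one le_rfl]
      exact Finset.sum_le_sum_of_subset_of_nonneg hS fun i _ _ => hμ.nonneg _ le_rfl i
    have h3 : 1 ≤ δ ^ s := Real.one_le_rpow h1.le hs.le
    nlinarith

lemma exists_pos_radii {s : ℝ} (hs : 0 < s) {t : ℕ → Set ℝ} {η : ℝ≥0∞}
    (ht : ∑' n, (⨆ _ : (t n).Nonempty, Metric.ediam (t n) ^ s) < η) :
    ∃ δ : ℕ → ℝ, (∀ n, 0 < δ n) ∧ (∀ n, Metric.ediam (t n) < ENNReal.ofReal (δ n)) ∧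
      ∑' n, ENNReal.ofReal (δ n ^ s) < η := by
  obtain ⟨ε, hε, hsum⟩ := ENNReal.exists_pos_sum_of_countable (tsub_pos_of_lt ht).ne' ℕ
  set v : ℕ → ℝ≥0∞ := fun n => ⨆ _ : (t n).Nonempty, Metric.ediam (t n) ^ s with hv
  have hvt : ∀ n, Metric.ediam (t n) ^ s ≤ v n := by
    intro n
    rcases (t n).eq_empty_or_nonempty with h | h
    · simp [h, hs]
    · simp [hv, h]
  have hvtop : ∀ n, v n ≠ ⊤ := fun n => ((ENNReal.le_tsum n).trans_lt (ht.trans_le le_top)).ne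
  have hw : ∀ n, v n + ε n ≠ ⊤ := fun n => by simp [hvtop n]
  have hwpos : ∀ n, 0 < (v n + ε n).toReal := fun n =>
    ENNReal.toReal_pos (by simpa using fun _ => (hε n).ne') (hw n)
  have key : ∀ n, ENNReal.ofReal ((v n + ε n).toReal ^ s⁻¹) ^ s = v n + ε n := by
    intro n
    rw [ENNReal.ofReal_rpow_of_nonneg (by positivity) hs.le, ← Real.rpow_mul (by positivity),
      inv_mul_cancel₀ hs.ne', Real.rpow_one, ENNReal.ofReal_toReal (hw n)]
  refine ⟨fun n => (v n + ε n).toReal ^ s⁻¹, fun n => Real.rpow_pos_of_pos (hwpos n) _, fun n => ?_,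
    ?_⟩
  · rw [← ENNReal.rpow_lt_rpow_iff hs, key]
    exact (hvt n).trans_lt (ENNReal.lt_add_right (hvtop n) (by simpa using (hε n).ne'))
  · have : ∀ n, ENNReal.ofReal (((v n + ε n).toReal ^ s⁻¹) ^ s) = v n + ε n := by
      intro n
      rw [← ENNReal.ofReal_rpow_of_nonneg (by positivity) hs.le, key n]
    simp only [this]
    rw [ENNReal.tsum_add]
    exact lt_tsub_iff_left.1 hsum

lemma sum_biUnion_le_sum_sum {f : ℕ → ℝ} (hf : ∀ k, 0 ≤ f k) (F : Finset ℕ) (S : ℕ → Finset ℕ) :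
    ∑ k ∈ F.biUnion S, f k ≤ ∑ i ∈ F, ∑ k ∈ S i, f k := by
  induction F using Finset.induction_on with
  | empty => simp
  | insert i F hi ih =>
    rw [Finset.biUnion_insert, Finset.sum_insert hi]
    have h1 := Finset.sum_union_inter (s₁ := S i) (s₂ := F.biUnion S) (f := f)
    have h2 : 0 ≤ ∑ k ∈ S i ∩ F.biUnion S, f k := Finset.sum_nonneg fun k _ => hf k
    linarith

theorem le_dimH_iInter_of_uniform_hausdorffContent {s : ℝ} (hs : 0 < s) (hs1 : s < 1)
    (U : ℕ → Set ℝ) (hU : ∀ j, IsOpen (U j))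
    (hc : ∀ j, ∃ c > 0, ∀ n, ∀ k < 2 ^ n,
      ENNReal.ofReal (c * ((1 / 2) ^ n) ^ s) ≤ hausdorffContent s (U j ∩ dyadicIco n k)) :
    ENNReal.ofReal s ≤ dimH (⋂ j, U j) := by
  set a : ℝ := (1 / 2) ^ s with ha'
  have ha : 1 / 2 < a := half_lt_half_rpow hs1
  have hlim : ∀ j n k, k < 2 ^ n → cutLim a (U j) n k = a ^ n := by
    intro j
    obtain ⟨c, hc0, hc⟩ := hc j
    intro n k hk
    refine cutLim_eq_of_uniform_lower_bound ha hc0 (fun n k hk => ?_) hk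
    have h1 := (hc n k hk).trans (hausdorffContent_inter_dyadicIco_le hs.le hs1 (hU j) n k)
    rw [ENNReal.ofReal_le_ofReal_iff (cutLim_nonneg ha.le n k)] at h1
    rwa [ha', Real.rpow_pow_comm (by norm_num)]
  obtain ⟨N, hN, K, hK, hmass⟩ := exists_dyadicMass_seq ha.le U hlim
  have hcontent : ENNReal.ofReal (1 / 16) ≤ hausdorffContent s (⋂ j, K j) := by
    by_contra! hlt
    rw [hausdorffContent, OuterMeasure.ofFunction_apply] at hlt
    simp only [iInf_lt_iff] at hlt
    obtain ⟨t, ht, hlt⟩ := hlt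
    obtain ⟨δ, hδ0, hδ, hsum⟩ := exists_pos_radii hs hlt
    have hball : ∀ i, ∃ x, t i ⊆ Metric.ball x (δ i) := by
      intro i
      rcases (t i).eq_empty_or_nonempty with h | ⟨x, hx⟩
      · exact ⟨0, by simp [h]⟩
      · refine ⟨x, fun y hy => ?_⟩
        have := (Metric.edist_le_ediam_of_mem hy hx).trans_lt (hδ i)
        rwa [edist_dist, ENNReal.ofReal_lt_ofReal_iff (hδ0 i)] at this
    choose x hx using hball
    obtain ⟨J, F, hJ⟩ : ∃ (J : ℕ) (F : Finset ℕ),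
        (⋂ i ≤ J, K i) ⊆ ⋃ i ∈ F, Metric.ball (x i) (δ i) := by
      have hO : IsOpen (⋃ i, Metric.ball (x i) (δ i)) := isOpen_iUnion fun i => Metric.isOpen_ball
      have hcov : ⋂ j, K j ⊆ ⋃ i, Metric.ball (x i) (δ i) := ht.trans (iUnion_mono hx)
      have hcomp : ∀ J, IsCompact (⋂ i ≤ J, K i) := fun J =>
        (hK 0).1.of_isClosed_subset
          (isClosed_biInter fun i _ => (hK i).1.isClosed) (biInter_subset_of_mem (Nat.zero_le J))
      have hanti : Antitone fun J => ⋂ i ≤ J, K i := fun J J' hJJ' y hy =>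
        mem_iInter₂.2 fun i hi => mem_iInter₂.1 hy i (hi.trans hJJ')
      obtain ⟨J, hJ⟩ := exists_subset_nhds_of_isCompact hanti.directed_ge hcomp
        (U := ⋃ i, Metric.ball (x i) (δ i)) fun y hy => hO.mem_nhds <| hcov <|
          mem_iInter.2 fun j => mem_iInter₂.1 (mem_iInter.1 hy j) j le_rfl
      obtain ⟨F, hF⟩ := (hcomp J).elim_finite_subcover _ (fun i => Metric.isOpen_ball) hJ
      exact ⟨J, F, hF⟩
    obtain ⟨j, hjJ, hjF⟩ : ∃ j, J < j ∧ ∀ i ∈ F, (1 / 2 : ℝ) ^ N j ≤ δ i := by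
      have h1 : Tendsto (fun j => (1 / 2 : ℝ) ^ N j) atTop (nhds 0) :=
        (tendsto_pow_atTop_nhds_zero_of_lt_one (by norm_num) (by norm_num)).comp hN.tendsto_atTop
      have h2 : ∀ᶠ j in atTop, ∀ i ∈ F, (1 / 2 : ℝ) ^ N j ≤ δ i := by
        rw [Finset.eventually_all]
        exact fun i _ => h1.eventually_le_const (hδ0 i)
      exact ((eventually_gt_atTop J).and h2).exists
    obtain ⟨μ, hμ, hμK⟩ := hmass j
    let S : ℕ → Finset ℕ := fun i => (Finset.range (2 ^ N j)).filter
      fun k => (k : ℝ) * (1 / 2) ^ N j ∈ Metric.ball (x i) (δ i)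
    have hle : (1 : ℝ) ≤ ∑ i ∈ F, 16 * δ i ^ s := by
      calc (1 : ℝ) = ∑ k ∈ Finset.range (2 ^ N j), μ (N j) k := (hμ.sum_eq_one le_rfl).symm
        _ = ∑ k ∈ (Finset.range (2 ^ N j)).filter (fun k => μ (N j) k ≠ 0), μ (N j) k :=
            (Finset.sum_filter_ne_zero _).symm
        _ ≤ ∑ k ∈ F.biUnion S, μ (N j) k := by
            refine Finset.sum_le_sum_of_subset_of_nonneg ?_ fun i _ _ => hμ.nonneg _ le_rfl i
            intro k hk
            rw [Finset.mem_filter] at hk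
            have hmem : (k : ℝ) * (1 / 2) ^ N j ∈ ⋂ i ≤ J, K i :=
              mem_iInter₂.2 fun i hi => hμK k hk.2 i (by omega)
            obtain ⟨i, hi, hki⟩ := mem_iUnion₂.1 (hJ hmem)
            exact Finset.mem_biUnion.2 ⟨i, hi, Finset.mem_filter.2 ⟨hk.1, hki⟩⟩
        _ ≤ ∑ i ∈ F, ∑ k ∈ S i, μ (N j) k :=
            sum_biUnion_le_sum_sum (hμ.nonneg _ le_rfl) F S
        _ ≤ ∑ i ∈ F, 16 * δ i ^ s := by
            refine Finset.sum_le_sum fun i hi => ?_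
            have := hμ.sum_ball_le hs hs1 one_le_two (x i) (hjF i hi)
              (Finset.filter_subset _ _ : S i ⊆ _) fun k hk => (Finset.mem_filter.1 hk).2
            linarith
    rw [← Finset.mul_sum] at hle
    have h3 : ∑ i ∈ F, ENNReal.ofReal (δ i ^ s) < ENNReal.ofReal (1 / 16) :=
      (ENNReal.sum_le_tsum F).trans_lt hsum
    have hnn : ∀ i ∈ F, 0 ≤ δ i ^ s := fun i _ => Real.rpow_nonneg (hδ0 i).le s
    rw [← ENNReal.ofReal_sum_of_nonneg hnn,
      ENNReal.ofReal_lt_ofReal_iff_of_nonneg (Finset.sum_nonneg hnn)] at h3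
    linarith
  have hne : Measure.hausdorffMeasure s (⋂ j, K j) ≠ 0 := by
    intro h0
    have := hcontent.trans ((hausdorffContent_le_hausdorffMeasure s _).trans h0.le)
    simp at this
  have hdim : ENNReal.ofNNReal ⟨s, hs.le⟩ ≤ dimH (⋂ j, K j) :=
    le_dimH_of_hausdorffMeasure_ne_zero hne
  rw [ENNReal.ofReal_eq_coe_nnreal hs.le]
  exact hdim.trans (dimH_mono (iInter_mono fun j => (hK j).2))

/-! ### The `β`-transformation -/

lemma betaMap_iterate_mem_Ico {β x : ℝ} (hx : x ∈ Ico (0 : ℝ) 1) (n : ℕ) :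
    (betaMap β)^[n] x ∈ Ico (0 : ℝ) 1 := by
  cases n with
  | zero => exact hx
  | succ n =>
    rw [Function.iterate_succ_apply']
    exact ⟨Int.fract_nonneg _, Int.fract_lt_one _⟩

lemma betaMap_iterate_mem_Icc (β : ℝ) (n : ℕ) : (betaMap β)^[n] 1 ∈ Icc (0 : ℝ) 1 := by
  cases n with
  | zero => simp
  | succ n =>
    rw [Function.iterate_succ_apply']
    exact ⟨Int.fract_nonneg _, (Int.fract_lt_one _).le⟩

lemma betaDigit_add (β x : ℝ) (n i : ℕ) :
    betaDigit β x (n + i) = betaDigit β ((betaMap β)^[n] x) i := by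
  simp only [betaDigit]
  rw [add_comm, Function.iterate_add_apply]

lemma betaMap_iterate_succ (β x : ℝ) (n : ℕ) :
    (betaMap β)^[n + 1] x = β * (betaMap β)^[n] x - betaDigit β x n := by
  rw [Function.iterate_succ_apply', betaDigit]
  rfl

lemma eventually_betaMap_iterate_eq {β : ℝ} (hβ : 0 < β) (x : ℝ) (n : ℕ) :
    ∀ᶠ y in nhdsWithin x (Ici x),
      (betaMap β)^[n] y = (betaMap β)^[n] x + β ^ n * (y - x) ∧
      betaDigit β y n = betaDigit β x n := by
  have step : ∀ n, (∀ᶠ y in nhdsWithin x (Ici x),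
      (betaMap β)^[n] y = (betaMap β)^[n] x + β ^ n * (y - x)) →
      ∀ᶠ y in nhdsWithin x (Ici x), (betaMap β)^[n] y = (betaMap β)^[n] x + β ^ n * (y - x) ∧
        betaDigit β y n = betaDigit β x n := by
    intro n hn
    have hlim : Tendsto (fun y => β * ((betaMap β)^[n] x + β ^ n * (y - x)))
        (nhdsWithin x (Ici x)) (nhdsWithin (β * (betaMap β)^[n] x) (Ici (β * (betaMap β)^[n] x))) := by
      refine tendsto_nhdsWithin_iff.2 ⟨?_, ?_⟩
      · have : Continuous fun y => β * ((betaMap β)^[n] x + β ^ n * (y - x)) := by fun_prop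
        simpa using (this.tendsto x).mono_left nhdsWithin_le_nhds
      · filter_upwards [self_mem_nhdsWithin] with y hy
        have : 0 ≤ β ^ n * (y - x) := mul_nonneg (by positivity) (sub_nonneg.2 hy)
        exact mul_le_mul_of_nonneg_left (by linarith) hβ.le
    have hfl := hlim.eventually (tendsto_pure.1 (tendsto_floor_right_pure_floor _))
    filter_upwards [hn, hfl] with y hy hy'
    refine ⟨hy, ?_⟩
    rw [betaDigit, hy, hy', betaDigit]
  induction n with
  | zero => exact step 0 (by simp)
  | succ n ih =>
    refine step _ (ih.mono fun y hy => ?_)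
    rw [betaMap_iterate_succ, betaMap_iterate_succ, hy.1, hy.2]
    ring

lemma betaFreq_congr {β : ℝ} {m : ℕ} (w : Fin m → Fin 2) {x y : ℝ} {n : ℕ}
    (h : ∀ i < n, betaDigit β y i = betaDigit β x i) : betaFreq β w y n = betaFreq β w x n := by
  unfold betaFreq
  congr 3
  refine Finset.filter_congr fun i hi => forall_congr' fun k => ?_
  rw [h _ (by have := Finset.mem_range.1 hi; have := k.2; omega)]

lemma eventually_betaFreq_eq {β : ℝ} (hβ : 0 < β) (m : ℕ) (x : ℝ) (n : ℕ) :
    ∀ᶠ y in nhdsWithin x (Ici x), ∀ w : Fin m → Fin 2, betaFreq β w y n = betaFreq β w x n := by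
  have : ∀ᶠ y in nhdsWithin x (Ici x), ∀ i ∈ Finset.range n, betaDigit β y i = betaDigit β x i := by
    rw [Finset.eventually_all]
    exact fun i _ => (eventually_betaMap_iterate_eq hβ x i).mono fun y hy => hy.2
  exact this.mono fun y hy w => betaFreq_congr w fun i hi => hy i (Finset.mem_range.2 hi)

lemma betaFreqAccum_iff {β : ℝ} {m : ℕ} {p : (Fin m → Fin 2) → ℝ} {x : ℝ} :
    betaFreqAccum β m p x ↔
      ∀ ε > 0, ∃ᶠ n in atTop, ∀ w : Fin m → Fin 2, |betaFreq β w x n - p w| < ε := by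
  rw [betaFreqAccum, Metric.nhds_basis_ball.mapClusterPt_iff_frequently]
  refine forall₂_congr fun ε hε => ?_
  simp only [Metric.mem_ball, dist_pi_lt_iff hε, Real.dist_eq]

lemma abs_betaFreq_add_sub_le (β : ℝ) {m : ℕ} (w : Fin m → Fin 2) (x : ℝ) (n : ℕ) {N : ℕ}
    (hN : m < N) :
    |betaFreq β w x (N + n) - betaFreq β w ((betaMap β)^[n] x) N| ≤ n / ((N - m : ℕ) : ℝ) := by
  obtain ⟨a, rfl⟩ : ∃ a, N = m + a := ⟨N - m, by omega⟩
  have ha : (0 : ℝ) < a := by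
    have : 0 < a := by omega
    exact_mod_cast this
  have h1 : m + a + n - m = n + a := by omega
  have h2 : m + a - m = a := by omega
  unfold betaFreq
  rw [h1, h2]
  set P : ℕ → Prop := fun i => ∀ k : Fin m, betaDigit β x (i + k) = ((w k : ℕ) : ℤ) with hP
  have hsplit : ((Finset.range (n + a)).filter P).card =
      ((Finset.range n).filter P).card +
      ((Finset.range a).filter (fun i => ∀ k : Fin m,
        betaDigit β ((betaMap β)^[n] x) (i + k) = ((w k : ℕ) : ℤ))).card := by
    simp only [Finset.card_filter]
    rw [Finset.sum_range_add]
    congr 1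
    refine Finset.sum_congr rfl fun i _ => ?_
    simp only [hP, ← betaDigit_add, add_assoc]
  have hc : ((Finset.range n).filter P).card ≤ n := by
    simpa using Finset.card_filter_le (Finset.range n) P
  set D := ((Finset.range a).filter (fun i => ∀ k : Fin m,
        betaDigit β ((betaMap β)^[n] x) (i + k) = ((w k : ℕ) : ℤ))).card
  have hD : D ≤ a := by
    simpa using Finset.card_filter_le (Finset.range a) (fun i => ∀ k : Fin m,
        betaDigit β ((betaMap β)^[n] x) (i + k) = ((w k : ℕ) : ℤ))
  rw [hsplit]
  set c := ((Finset.range n).filter P).card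
  have hc' : (c : ℝ) ≤ n := by exact_mod_cast hc
  have hD' : (D : ℝ) ≤ a := by exact_mod_cast hD
  have hn : (0 : ℝ) ≤ n := n.cast_nonneg
  have hc0 : (0 : ℝ) ≤ c := c.cast_nonneg
  have hD0 : (0 : ℝ) ≤ D := D.cast_nonneg
  push_cast
  have e : ((c : ℝ) + D) / (n + a) - D / a = ((c * a - n * D) / (n + a)) / a := by
    field_simp
    ring
  rw [e, abs_div, abs_of_pos ha]
  refine div_le_div_of_nonneg_right ?_ ha.le
  rw [abs_div, abs_of_pos (by linarith : (0 : ℝ) < n + a), div_le_iff₀ (by linarith), abs_le]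
  constructor <;> nlinarith [mul_le_mul_of_nonneg_right hc' ha.le, mul_le_mul_of_nonneg_left hD' hn,
    mul_nonneg hc0 ha.le, mul_nonneg hn hD0, mul_nonneg hn hn]

lemma betaFreqAccum_of_iterate {β : ℝ} {m : ℕ} {p : (Fin m → Fin 2) → ℝ} {x : ℝ} (n : ℕ)
    (h : betaFreqAccum β m p ((betaMap β)^[n] x)) : betaFreqAccum β m p x := by
  rw [betaFreqAccum_iff] at h ⊢
  intro ε hε
  have hlim : Tendsto (fun N : ℕ => (n : ℝ) / ((N - m : ℕ) : ℝ)) atTop (nhds 0) :=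
    tendsto_const_nhds.div_atTop
      (tendsto_natCast_atTop_atTop.comp (tendsto_sub_atTop_nat m))
  have hev := (hlim.eventually_lt_const (half_pos hε)).and (eventually_gt_atTop m)
  have := (h (ε / 2) (half_pos hε)).and_eventually hev
  refine Tendsto.frequently (tendsto_add_atTop_nat n) (this.mono fun N hN w => ?_)
  have h1 := abs_betaFreq_add_sub_le β w x n hN.2.2
  have h2 := abs_sub_le (betaFreq β w x (N + n)) (betaFreq β w ((betaMap β)^[n] x) N) (p w)
  linarith [hN.1 w, hN.2.1]

lemma exists_betaMap_cylinder {β : ℝ} (hβ : 0 < β) {x : ℝ} (hx : x ∈ Ico (0 : ℝ) 1) (n : ℕ) :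
    ∃ j, (betaMap β)^[n] x < (betaMap β)^[j] 1 ∧ ∀ y, 0 ≤ y → y < (betaMap β)^[j] 1 →
      x + (y - (betaMap β)^[n] x) * (1 / β) ^ n ∈ Ico (0 : ℝ) 1 ∧
      (betaMap β)^[n] (x + (y - (betaMap β)^[n] x) * (1 / β) ^ n) = y := by
  induction n with
  | zero =>
    refine ⟨0, by simpa using hx.2, fun y hy hy1 => ?_⟩
    simp only [Function.iterate_zero, id] at hy1 ⊢
    refine ⟨?_, by ring⟩
    rw [pow_zero]
    constructor <;> linarith
  | succ n ih =>
    obtain ⟨j, hj, ih⟩ := ih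
    set t := (betaMap β)^[n] x with ht
    set u := (betaMap β)^[j] 1 with hu
    set d : ℤ := ⌊β * t⌋ with hd
    have hsucc : (betaMap β)^[n + 1] x = β * t - d := betaMap_iterate_succ β x n
    have hd0 : (0 : ℝ) ≤ d := by
      exact_mod_cast Int.floor_nonneg.2 (mul_nonneg hβ.le (betaMap_iterate_mem_Ico hx n).1)
    have ht1 : β * t - d ∈ Ico (0 : ℝ) 1 :=
      ⟨sub_nonneg.2 (Int.floor_le _), by linarith [Int.lt_floor_add_one (β * t)]⟩
    have htu : β * t < β * u := mul_lt_mul_of_pos_left hj hβ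
    have hj' : ∃ j', β * t - d < (betaMap β)^[j'] 1 ∧ (betaMap β)^[j'] 1 ≤ 1 ∧
        (betaMap β)^[j'] 1 ≤ β * u - d := by
      rcases le_or_gt 1 (β * u - d) with h | h
      · exact ⟨0, by simpa using ht1.2, by simp, by simpa using h⟩
      · have hfl : ⌊β * u⌋ = d := by
          rw [Int.floor_eq_iff]
          constructor <;> linarith [ht1.1]
        have : (betaMap β)^[j + 1] 1 = β * u - d := by
          rw [betaMap_iterate_succ, betaDigit, ← hu, hfl]
        exact ⟨j + 1, by rw [this]; linarith, by rw [this]; exact h.le, this.le⟩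
    obtain ⟨j', h1, h2, h3⟩ := hj'
    refine ⟨j', by rwa [hsucc], fun y hy hyj => ?_⟩
    have hz : x + (y - (betaMap β)^[n + 1] x) * (1 / β) ^ (n + 1) =
        x + ((d + y) / β - t) * (1 / β) ^ n := by
      rw [hsucc, pow_succ]
      field_simp
      ring
    have hlt : (d + y) / β < u := by
      rw [div_lt_iff₀ hβ]
      linarith
    obtain ⟨h4, h5⟩ := ih ((d + y) / β) (by positivity) hlt
    rw [hz]
    refine ⟨h4, ?_⟩
    rw [Function.iterate_succ_apply', h5, betaMap, mul_div_cancel₀ _ hβ.ne', Int.fract_intCast_add,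
      Int.fract_eq_self]
    exact ⟨hy, hyj.trans_le h2⟩

lemma betaMap_iterate_mul_pow {β : ℝ} (hβ : 1 < β) {y : ℝ} (hy : y ∈ Ico (0 : ℝ) 1) (n : ℕ) :
    (betaMap β)^[n] (y * (1 / β) ^ n) = y := by
  have hβ0 : 0 < β := by linarith
  induction n with
  | zero => simp
  | succ n ih =>
    have h1 : (1 / β) ^ n ≤ 1 := pow_le_one₀ (by positivity) ((div_le_one hβ0).2 hβ.le)
    have h0 : 0 < (1 / β) ^ n := by positivity
    have : betaMap β (y * (1 / β) ^ (n + 1)) = y * (1 / β) ^ n := by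
      have : β * (y * (1 / β) ^ (n + 1)) = y * (1 / β) ^ n := by
        rw [pow_succ]
        field_simp
      rw [betaMap, this, Int.fract_eq_self]
      exact ⟨mul_nonneg hy.1 h0.le, by nlinarith [hy.1, hy.2]⟩
    rw [Function.iterate_succ_apply, this, ih]

lemma TerminatesAtOne.exists_orbit_eq_zero {β : ℝ} (hβ : 1 < β) (h : TerminatesAtOne β) :
    ∃ N, ∀ n ≥ N, (betaMap β)^[n] 1 = 0 := by
  obtain ⟨N, hN⟩ := h
  have hβ0 : 0 < β := by linarith
  have hpow : ∀ M ≥ N, ∀ i, (betaMap β)^[M + i] 1 = β ^ i * (betaMap β)^[M] 1 := by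
    intro M hM i
    induction i with
    | zero => simp
    | succ i ih =>
      rw [← add_assoc, betaMap_iterate_succ, hN (M + i) (by omega), ih, pow_succ]
      push_cast
      ring
  refine ⟨N, fun M hM => ?_⟩
  by_contra hne
  have hpos : 0 < (betaMap β)^[M] 1 := lt_of_le_of_ne (betaMap_iterate_mem_Icc β M).1 (Ne.symm hne)
  obtain ⟨i, hi⟩ := pow_unbounded_of_one_lt (1 / (betaMap β)^[M] 1) hβ
  have h1 := (betaMap_iterate_mem_Icc β (M + i)).2
  rw [hpow M hM i] at h1
  rw [div_lt_iff₀ hpos] at hi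
  linarith

lemma TerminatesAtOne.exists_le_orbit {β : ℝ} (hβ : 1 < β) (h : TerminatesAtOne β) :
    ∃ δ > 0, ∀ j, 0 < (betaMap β)^[j] 1 → δ ≤ (betaMap β)^[j] 1 := by
  obtain ⟨N, hN⟩ := h.exists_orbit_eq_zero hβ
  have hev : ∀ᶠ δ in nhdsWithin (0 : ℝ) (Ioi 0), ∀ j ∈ Finset.range N,
      0 < (betaMap β)^[j] 1 → δ ≤ (betaMap β)^[j] 1 := by
    rw [Finset.eventually_all]
    intro j _
    by_cases hj : 0 < (betaMap β)^[j] 1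
    · filter_upwards [mem_nhdsWithin_of_mem_nhds (Iic_mem_nhds hj)] with δ hδ _ using hδ
    · exact Eventually.of_forall fun δ h => absurd h hj
  obtain ⟨δ, hδ, hδ0⟩ := (hev.and self_mem_nhdsWithin).exists
  refine ⟨δ, hδ0, fun j hj => ?_⟩
  rcases lt_or_ge j N with h | h
  · exact hδ j (Finset.mem_range.2 h) hj
  · exact absurd hj (hN j h).le.not_gt

lemma TerminatesAtOne.exists_full_cylinder {β : ℝ} (hβ : 1 < β) (h : TerminatesAtOne β) :
    ∃ κ : ℕ, ∀ x ∈ Ico (0 : ℝ) 1, ∀ n, ∃ a, x - (1 / β) ^ n < a ∧ a ≤ x ∧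
      ∀ y ∈ Ico (0 : ℝ) 1, a + (1 / β) ^ (n + κ) * y ∈ Ico (0 : ℝ) 1 ∧
        (betaMap β)^[n + κ] (a + (1 / β) ^ (n + κ) * y) = y := by
  have hβ0 : 0 < β := by linarith
  obtain ⟨δ, hδ0, hδ⟩ := h.exists_le_orbit hβ
  obtain ⟨κ, hκ⟩ := exists_pow_lt_of_lt_one hδ0 ((div_lt_one hβ0).2 hβ)
  refine ⟨κ, fun x hx n => ?_⟩
  obtain ⟨j, hj, hcyl⟩ := exists_betaMap_cylinder hβ0 hx n
  have ht := betaMap_iterate_mem_Ico (β := β) hx n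
  set t := (betaMap β)^[n] x
  have hn : 0 < (1 / β) ^ n := by positivity
  refine ⟨x - t * (1 / β) ^ n, by nlinarith [ht.2], by nlinarith [ht.1], fun y hy => ?_⟩
  have hκ0 : 0 < (1 / β) ^ κ := by positivity
  have hlt : y * (1 / β) ^ κ < (betaMap β)^[j] 1 :=
    lt_of_lt_of_le (by nlinarith [hy.1, hy.2]) (hδ j (ht.1.trans_lt hj))
  obtain ⟨h1, h2⟩ := hcyl (y * (1 / β) ^ κ) (mul_nonneg hy.1 hκ0.le) hlt
  have hz : x - t * (1 / β) ^ n + (1 / β) ^ (n + κ) * y =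
      x + (y * (1 / β) ^ κ - t) * (1 / β) ^ n := by
    rw [pow_add]
    ring
  rw [hz]
  refine ⟨h1, ?_⟩
  rw [add_comm n κ, Function.iterate_add_apply, h2, betaMap_iterate_mul_pow hβ hy]

lemma exists_le_hausdorffContent_inter_Ico {β s : ℝ} (hβ : 1 < β) (h : TerminatesAtOne β)
    (hs : 0 < s) {E : Set ℝ} (hE : E ⊆ Ico 0 1)
    (hinv : ∀ x ∈ Ico (0 : ℝ) 1, ∀ n, (betaMap β)^[n] x ∈ E → x ∈ E)
    (hpos : hausdorffContent s E ≠ 0) :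
    ∃ c > 0, ∀ α r : ℝ, 0 ≤ α → 0 < r → α + r ≤ 1 →
      ENNReal.ofReal (c * r ^ s) ≤ hausdorffContent s (E ∩ Ico α (α + r)) := by
  have hβ0 : 0 < β := by linarith
  obtain ⟨κ, hκ⟩ := h.exists_full_cylinder hβ
  obtain ⟨c₁, hc₁, hc₁E⟩ := ENNReal.lt_iff_exists_nnreal_btwn.1 (pos_iff_ne_zero.2 hpos)
  have hc₁0 : (0 : ℝ) < c₁ := by exact_mod_cast hc₁
  set c₀ : ℝ := (1 / β) ^ κ * (1 / β) / 2 with hc₀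
  have hc₀0 : 0 < c₀ := by positivity
  refine ⟨c₀ ^ s * c₁, mul_pos (Real.rpow_pos_of_pos hc₀0 s) hc₁0, fun α r hα hr hαr => ?_⟩
  obtain ⟨n, hn1, hn2⟩ := exists_nat_pow_near_of_lt_one (half_pos hr) (by linarith)
    (by positivity : 0 < 1 / β) ((div_lt_one hβ0).2 hβ)
  obtain ⟨a, ha1, ha2, ha⟩ := hκ (α + r / 2) ⟨by linarith, by linarith⟩ (n + 1)
  set ρ : ℝ := (1 / β) ^ (n + 1 + κ) with hρ
  have hρ0 : 0 < ρ := by positivity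
  have hρn : ρ ≤ (1 / β) ^ (n + 1) :=
    pow_le_pow_of_le_one (by positivity) ((div_le_one hβ0).2 hβ.le) (by omega)
  have hle : c₀ * r ≤ ρ := by
    have : ρ = (1 / β) ^ κ * (1 / β) * (1 / β) ^ n := by rw [hρ, pow_add, pow_succ]; ring
    rw [this, hc₀]
    have : 0 < (1 / β) ^ κ * (1 / β) := by positivity
    nlinarith
  have himg : (fun y => a + ρ * y) '' E ⊆ E ∩ Ico α (α + r) := by
    rintro _ ⟨y, hy, rfl⟩
    obtain ⟨h1, h2⟩ := ha y (hE hy)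
    have hy0 := (hE hy).1
    have hy1 := (hE hy).2
    refine ⟨hinv _ h1 _ (by rwa [h2]), ?_, ?_⟩
    · have := mul_nonneg hρ0.le hy0
      show α ≤ a + ρ * y
      linarith
    · show a + ρ * y < α + r
      nlinarith
  calc ENNReal.ofReal (c₀ ^ s * c₁ * r ^ s)
      = ENNReal.ofReal ((c₀ * r) ^ s) * c₁ := by
        rw [Real.mul_rpow hc₀0.le hr.le, mul_right_comm, ENNReal.ofReal_mul (by positivity),
          ENNReal.ofReal_coe_nnreal]
    _ ≤ ENNReal.ofReal (ρ ^ s) * hausdorffContent s E := by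
        gcongr
    _ ≤ _ := (le_hausdorffContent_image_affine hs E a hρ0).trans (measure_mono himg)

/-! ### Right-open sets -/

lemma countable_diff_interior_of_right_open {V : Set ℝ}
    (hV : ∀ x ∈ V, V ∈ nhdsWithin x (Ici x)) : (V \ interior V).Countable := by
  have hcount := countable_setOfPred_isolated_right_within (s := V \ interior V)
  refine hcount.mono fun x hx => ?_
  refine (⟨hx, ?_⟩ : x ∈ V \ interior V ∧ nhdsWithin x (V \ interior V ∩ Ioi x) = ⊥)
  obtain ⟨u, hu, huV⟩ := mem_nhdsGE_iff_exists_Ico_subset.1 (hV x hx.1)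
  have hIoo : Ioo x u ⊆ interior V :=
    interior_maximal (Ioo_subset_Ico_self.trans huV) isOpen_Ioo
  rw [← empty_mem_iff_bot, mem_nhdsWithin]
  exact ⟨Iio u, isOpen_Iio, hu, fun y hy => hy.2.1.2 (hIoo ⟨hy.2.2, hy.1⟩)⟩

/-- Points whose empirical frequencies come within `1 / (k + 1)` of `p` at some time `n ≥ k`. -/
def betaFreqNear (β : ℝ) (m : ℕ) (p : (Fin m → Fin 2) → ℝ) (k : ℕ) : Set ℝ :=
  {x ∈ Ico (0 : ℝ) 1 | ∃ n ≥ k, ∀ w : Fin m → Fin 2, |betaFreq β w x n - p w| < 1 / (k + 1)}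

lemma betaFreqNear_mem_nhdsGE {β : ℝ} (hβ : 0 < β) {m : ℕ} {p : (Fin m → Fin 2) → ℝ} {k : ℕ}
    {x : ℝ} (hx : x ∈ betaFreqNear β m p k) : betaFreqNear β m p k ∈ nhdsWithin x (Ici x) := by
  obtain ⟨hx01, n, hn, h⟩ := hx
  filter_upwards [eventually_betaFreq_eq hβ m x n, Ico_mem_nhdsGE hx01.2] with y hy hy1
  exact ⟨⟨hx01.1.trans hy1.1, hy1.2⟩, n, hn, fun w => by rw [hy w]; exact h w⟩

lemma betaFreqAccum_subset_betaFreqNear (β : ℝ) (m : ℕ) (p : (Fin m → Fin 2) → ℝ) (k : ℕ) :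
    {x ∈ Ico (0 : ℝ) 1 | betaFreqAccum β m p x} ⊆ betaFreqNear β m p k := by
  rintro x ⟨hx, h⟩
  obtain ⟨n, hn, hw⟩ := frequently_atTop.1
    (betaFreqAccum_iff.1 h (1 / (k + 1)) Nat.one_div_pos_of_nat) k
  exact ⟨hx, n, hn, hw⟩

lemma iInter_betaFreqNear_subset (β : ℝ) (m : ℕ) (p : (Fin m → Fin 2) → ℝ) :
    ⋂ k, betaFreqNear β m p k ⊆ {x ∈ Ico (0 : ℝ) 1 | betaFreqAccum β m p x} := by
  intro x hx
  rw [mem_iInter] at hx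
  refine ⟨(hx 0).1, betaFreqAccum_iff.2 fun ε hε => frequently_atTop.2 fun N => ?_⟩
  obtain ⟨k, hk⟩ := exists_nat_one_div_lt hε
  obtain ⟨-, n, hn, h⟩ := hx (max k N)
  refine ⟨n, (le_max_right _ _).trans hn, fun w => (h w).trans_le (le_trans ?_ hk.le)⟩
  exact one_div_le_one_div_of_le (by positivity) (by simp)

lemma hausdorffContent_le_interior_betaFreqNear {β s : ℝ} (hβ : 0 < β) (hs : 0 < s) (m : ℕ)
    (p : (Fin m → Fin 2) → ℝ) (k : ℕ) (I : Set ℝ) :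
    hausdorffContent s ({x ∈ Ico (0 : ℝ) 1 | betaFreqAccum β m p x} ∩ I) ≤
      hausdorffContent s (interior (betaFreqNear β m p k) ∩ I) := by
  set V := betaFreqNear β m p k
  have hsub : {x ∈ Ico (0 : ℝ) 1 | betaFreqAccum β m p x} ∩ I ⊆
      interior V ∩ I ∪ (V \ interior V) := by
    rintro x ⟨hx, hxI⟩
    by_cases h : x ∈ interior V
    · exact Or.inl ⟨h, hxI⟩
    · exact Or.inr ⟨betaFreqAccum_subset_betaFreqNear β m p k hx, h⟩
  have h0 : hausdorffContent s (V \ interior V) = 0 := hausdorffContent_of_countable hs <|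
    countable_diff_interior_of_right_open fun x hx => betaFreqNear_mem_nhdsGE hβ hx
  calc _ ≤ _ := (measure_mono hsub).trans (measure_union_le _ _)
    _ = _ := by rw [h0, add_zero]

lemma exists_le_hausdorffContent_interior_betaFreqNear {β s : ℝ} (hβ : 1 < β)
    (h : TerminatesAtOne β) (hs : 0 < s) {m : ℕ} {p : (Fin m → Fin 2) → ℝ}
    (hpos : hausdorffContent s {x ∈ Ico (0 : ℝ) 1 | betaFreqAccum β m p x} ≠ 0) (l : ℕ) :
    ∃ c > 0, ∀ n, ∀ k < 2 ^ n, ENNReal.ofReal (c * ((1 / 2) ^ n) ^ s) ≤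
      hausdorffContent s (interior (betaFreqNear β m p l) ∩ dyadicIco n k) := by
  obtain ⟨c, hc0, hc⟩ := exists_le_hausdorffContent_inter_Ico hβ h hs
    (E := {x ∈ Ico (0 : ℝ) 1 | betaFreqAccum β m p x}) (fun x hx => hx.1)
    (fun x hx n hn => ⟨hx, betaFreqAccum_of_iterate n hn.2⟩) hpos
  refine ⟨c, hc0, fun n k hk => (hc (k * (1 / 2) ^ n) ((1 / 2) ^ n) (by positivity)
    (by positivity) ?_).trans
    (hausdorffContent_le_interior_betaFreqNear (by linarith) hs m p l _)⟩
  have hk' : (k : ℝ) + 1 ≤ 2 ^ n := by exact_mod_cast hk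
  calc (k : ℝ) * (1 / 2) ^ n + (1 / 2) ^ n = (k + 1) * (1 / 2) ^ n := by ring
    _ ≤ 2 ^ n * (1 / 2) ^ n := by gcongr
    _ = 1 := by rw [← mul_pow]; norm_num

/-- for a sequence `(βᵢ) ⊆ (1,2)` with terminating expansions of `1`,
the Hausdorff dimension of the countable intersection of the accumulation-frequency
sets `{x : p̄ᵢ ∈ A^{βᵢ,mᵢ}(x)}` equals the infimum of their dimensions. -/
theorem dimH_iInter_betaFreqAccum (β : ℕ → ℝ)
    (hβ : ∀ i, 1 < β i ∧ β i < 2 ∧ TerminatesAtOne (β i))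
    (m : ℕ → ℕ) (hm : ∀ i, 0 < m i)
    (p : ∀ i, (Fin (m i) → Fin 2) → ℝ) (hp : ∀ i w, p i w ∈ Set.Icc (0:ℝ) 1) :
    dimH (⋂ i, {x ∈ Ico (0:ℝ) 1 | betaFreqAccum (β i) (m i) (p i) x}) =
      ⨅ i, dimH {x ∈ Ico (0:ℝ) 1 | betaFreqAccum (β i) (m i) (p i) x} := by
  refine le_antisymm (le_iInf fun i => dimH_mono (iInter_subset _ i)) ?_
  refine ENNReal.le_of_forall_nnreal_lt fun s hs => ?_
  rcases eq_zero_or_pos s with rfl | hs0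
  · simp
  have hs0' : (0 : ℝ) < s := hs0
  have hlt : ∀ i, (s : ℝ≥0∞) < dimH {x ∈ Ico (0:ℝ) 1 | betaFreqAccum (β i) (m i) (p i) x} :=
    fun i => hs.trans_le (iInf_le _ i)
  have hs1 : (s : ℝ) < 1 := by
    have := (hlt 0).trans_le ((dimH_mono (subset_univ _)).trans Real.dimH_univ.le)
    exact_mod_cast this
  have hpos : ∀ i, hausdorffContent s
      {x ∈ Ico (0:ℝ) 1 | betaFreqAccum (β i) (m i) (p i) x} ≠ 0 := fun i h0 => by
    have h1 := hausdorffMeasure_of_lt_dimH (hlt i)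
    rw [hausdorffMeasure_eq_zero_of_hausdorffContent hs0' h0] at h1
    exact ENNReal.zero_ne_top h1
  have key := le_dimH_iInter_of_uniform_hausdorffContent hs0' hs1
    (fun j => interior (betaFreqNear (β j.unpair.1) (m j.unpair.1) (p j.unpair.1) j.unpair.2))
    (fun j => isOpen_interior)
    (fun j => exists_le_hausdorffContent_interior_betaFreqNear (hβ _).1 (hβ _).2.2 hs0' (hpos _) _)
  rw [ENNReal.ofReal_coe_nnreal] at key
  refine key.trans (dimH_mono fun x hx => mem_iInter.2 fun i =>
    iInter_betaFreqNear_subset _ _ _ (mem_iInter.2 fun l => ?_))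
  have hpair : ∀ q : ℕ × ℕ, q = (i, l) →
      x ∈ interior (betaFreqNear (β q.1) (m q.1) (p q.1) q.2) →
        x ∈ betaFreqNear (β i) (m i) (p i) l := by
    rintro _ rfl h
    exact interior_subset h
  exact hpair _ (Nat.unpair_pair i l) (mem_iInter.1 hx (Nat.pair i l))
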